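/- arXiv:2407.14082 — 2 statements merged into one kernel-verified Lean document; each statement's English description precedes it below -/
import Mathlib

section
/- Let k be a field, n ≥ 1, R = k[x_0,…,x_n]. Let A be a b×a matrix over R with a < b such that the R-linear map α : R^a → R^b, v ↦ A·v, is injective, and suppose that the ideal of R generated by the a×a minors of A has height at least 3. Then the cokernel R^b / α(R^a) is a reflexive R-module. -/
/-- The height of an ideal: the infimum of the heights of the prime ideals containing it. -/
noncomputable def idealHeight {R : Type*} [CommRing R] (I : Ideal R) : ℕ∞ :=
  ⨅ (p : PrimeSpectrum R) (_ : I ≤ p.asIdeal), Order.height p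

namespace Refl

/-- `p` associated to `S/(x,y)` with `x, y` coprime has height at most two. -/
def Unm (S : Type*) [CommRing S] : Prop :=
  ∀ (x y s : S) (p : Ideal S), p.IsPrime → x ≠ 0 → IsRelPrime x y → x ∈ p → y ∈ p →
    s ∉ Ideal.span {x, y} → (∀ q ∈ p, q * s ∈ Ideal.span {x, y}) → p.height ≤ 2

lemma ass_data {S : Type*} [CommRing S] [IsNoetherianRing S] (K P : Ideal S)
    (hP : P ∈ associatedPrimes S (S ⧸ K)) :
    P.IsPrime ∧ K ≤ P ∧ ∃ s, s ∉ K ∧ ∀ q ∈ P, q * s ∈ K := by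
  rw [AssociatedPrimes.mem_iff, isAssociatedPrime_iff] at hP
  obtain ⟨hp, x, hx⟩ := hP
  obtain ⟨s, rfl⟩ := Ideal.Quotient.mk_surjective x
  have key : ∀ q, q ∈ P ↔ q * s ∈ K := by
    intro q
    rw [hx, Submodule.mem_colon_singleton, Submodule.mem_bot, ← Ideal.Quotient.eq_zero_iff_mem,
      map_mul]
    rfl
  refine ⟨hp, fun q hq => (key q).2 (K.mul_mem_right _ hq), s, fun hs => hp.ne_top ?_,
    fun q hq => (key q).1 hq⟩
  exact (Ideal.eq_top_iff_one _).2 ((key 1).2 (by simpa using hs))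

lemma ass_ann {S : Type*} [CommRing S] [IsNoetherianRing S] (K : Ideal S) (s : S) (hs : s ∉ K) :
    ∃ P ∈ associatedPrimes S (S ⧸ K), ∀ q, q * s ∈ K → q ∈ P := by
  obtain ⟨P, hP, h⟩ := exists_le_isAssociatedPrime_of_isNoetherianRing S
    (Ideal.Quotient.mk K s) (by rwa [Ne, Ideal.Quotient.eq_zero_iff_mem])
  refine ⟨P, hP, fun q hq => h ?_⟩
  rw [Submodule.mem_colon_singleton, Submodule.mem_bot]
  rw [← Ideal.Quotient.eq_zero_iff_mem, map_mul] at hq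
  exact hq

lemma exists_relprime {S : Type*} [CommRing S] [IsDomain S] [UniqueFactorizationMonoid S]
    [IsNoetherianRing S] (I : Ideal S) (hI : ∀ P : Ideal S, P.IsPrime → I ≤ P → 2 ≤ P.height)
    (x : S) (hx : x ≠ 0) : ∃ t ∈ I, IsRelPrime x t := by
  classical
  obtain ⟨f, hf, hfx⟩ := UniqueFactorizationMonoid.exists_prime_factors x hx
  by_contra! hcon
  have hsub : (I : Set S) ⊆ ⋃ q ∈ ((f.toFinset : Finset S) : Set S),
      ((Ideal.span {q} : Ideal S) : Set S) := by
    intro t ht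
    have := hcon t ht
    rw [UniqueFactorizationMonoid.isRelPrime_iff_no_prime_factors hx] at this
    push Not at this
    obtain ⟨d, hdx, hdt, hd⟩ := this
    obtain ⟨q, hq, hdq⟩ := hd.exists_mem_multiset_dvd (hdx.trans hfx.symm.dvd)
    have hass := (hd.associated_of_dvd (hf q hq) hdq)
    simp only [Set.mem_iUnion]
    exact ⟨q, by simpa using hq, Ideal.mem_span_singleton.2 (hass.symm.dvd.trans hdt)⟩
  rw [Ideal.subset_union_prime_finite (Finset.finite_toSet _) 0 0] at hsub
  · obtain ⟨q, hq, hle⟩ := hsub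
    have hqp : Prime q := hf q (by simpa using hq)
    have h2 := hI _ ((Ideal.span_singleton_prime hqp.ne_zero).2 hqp) hle
    have h1 := Ideal.height_span_singleton_le_one hqp.not_isUnit
    exact absurd (h2.trans h1) (by decide)
  · intro q hq _ _
    have hqp : Prime q := hf q (by simpa using hq)
    exact (Ideal.span_singleton_prime hqp.ne_zero).2 hqp

/-- Exchange the second element of a regular pair. -/
lemma exchange {S : Type*} [CommRing S] [IsDomain S] [UniqueFactorizationMonoid S]
    (p : Ideal S) (x y t s : S) (hx : x ≠ 0) (hxy : IsRelPrime x y) (hxt : IsRelPrime x t)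
    (ht : t ∈ p) (hs : s ∉ Ideal.span {x, y}) (hps : ∀ q ∈ p, q * s ∈ Ideal.span {x, y}) :
    ∃ s', s' ∉ Ideal.span {x, t} ∧ ∀ q ∈ p, q * s' ∈ Ideal.span {x, t} := by
  simp only [Ideal.mem_span_pair] at *
  obtain ⟨a, b, hab⟩ := hps t ht
  refine ⟨b, ?_, ?_⟩
  · rintro ⟨c, d, hcd⟩
    have h1 : x ∣ t * (s - y * d) := ⟨a + c * y, by linear_combination (-1) * hab + y * (-hcd)⟩
    obtain ⟨e, he⟩ := hxt.dvd_of_dvd_mul_left h1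
    exact hs ⟨e, d, by linear_combination -he⟩
  · intro q hq
    obtain ⟨c, d, hcd⟩ := hps q hq
    have h1 : x ∣ y * (q * b - t * d) := ⟨t * c - q * a, by
      linear_combination q * hab - t * hcd⟩
    obtain ⟨e, he⟩ := hxy.dvd_of_dvd_mul_left h1
    exact ⟨e, d, by linear_combination -he⟩

/-- An unmixedness contradiction: a prime with a regular triple is not associated to a regular
pair. -/
lemma no_socle {S : Type*} [CommRing S] [IsDomain S] [UniqueFactorizationMonoid S]
    [IsNoetherianRing S] (p : Ideal S) (hp : p.IsPrime) (h2 : 2 ≤ p.height)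
    (x y s : S) (hx : x ≠ 0) (hxp : x ∈ p) (hxy : IsRelPrime x y)
    (hs : s ∉ Ideal.span {x, y}) (hps : ∀ q ∈ p, q * s ∈ Ideal.span {x, y})
    (u v w : S) (hu : u ≠ 0) (hup : u ∈ p) (hvp : v ∈ p) (hwp : w ∈ p) (huv : IsRelPrime u v)
    (hw : ∀ r, w * r ∈ Ideal.span {u, v} → r ∈ Ideal.span {u, v}) : False := by
  obtain ⟨t, htp, ht⟩ := exists_relprime p (fun P _ hP => h2.trans (Ideal.height_mono hP))
    (x * u) (mul_ne_zero hx hu)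
  have hxt : IsRelPrime x t := ht.of_mul_left_left
  have hut : IsRelPrime u t := ht.of_mul_left_right
  have ht0 : t ≠ 0 := by
    rintro rfl
    exact hp.ne_top (Ideal.eq_top_of_isUnit_mem _ hxp (hxt dvd_rfl (dvd_zero _)))
  obtain ⟨s1, hs1, hps1⟩ := exchange p x y t s hx hxy hxt htp hs hps
  rw [Set.pair_comm] at hs1 hps1
  obtain ⟨s2, hs2, hps2⟩ := exchange p t x u s1 ht0 hxt.symm hut.symm hup hs1 hps1
  rw [Set.pair_comm] at hs2 hps2
  obtain ⟨s3, hs3, hps3⟩ := exchange p u t v s2 hu hut huv hvp hs2 hps2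
  exact hs3 (hw s3 (hps3 w hwp))

lemma Unm.exists_regular {S : Type*} [CommRing S] [IsNoetherianRing S] (hS : Unm S)
    (I : Ideal S) (hI : ∀ P : Ideal S, P.IsPrime → I ≤ P → 3 ≤ P.height)
    (x y : S) (hx : x ≠ 0) (hxy : IsRelPrime x y) :
    ∃ z ∈ I, ∀ r, z * r ∈ Ideal.span {x, y} → r ∈ Ideal.span {x, y} := by
  by_contra! hcon
  have hsub : (I : Set S) ⊆ ⋃ P ∈ associatedPrimes S (S ⧸ Ideal.span {x, y}), (P : Set S) := by
    intro z hz
    obtain ⟨r, hr, hr'⟩ := hcon z hz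
    obtain ⟨P, hP, h⟩ := ass_ann _ r hr'
    simp only [Set.mem_iUnion]
    exact ⟨P, hP, h z hr⟩
  rw [Ideal.subset_union_prime_finite (associatedPrimes.finite _ _) (f := fun P => P) 0 0
    (fun i hi _ _ => (ass_data _ i hi).1)] at hsub
  obtain ⟨P, hP, hle⟩ := hsub
  obtain ⟨h1, h2, s, hs, hs'⟩ := ass_data _ P hP
  have := hS x y s P h1 hx hxy (h2 (Ideal.subset_span (by simp)))
    (h2 (Ideal.subset_span (by simp))) hs hs'
  exact absurd ((hI P h1 hle).trans this) (by decide)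

lemma Unm.of_equiv {S T : Type*} [CommRing S] [CommRing T] (e : S ≃+* T) (hS : Unm S) :
    Unm T := by
  intro x y s p hp hx hxy hxp hyp hs hps
  have key : ∀ r : T, e.symm r ∈ Ideal.span {e.symm x, e.symm y} ↔ r ∈ Ideal.span {x, y} := by
    intro r
    simp only [Ideal.mem_span_pair]
    constructor
    · rintro ⟨a, b, h⟩
      exact ⟨e a, e b, e.symm.injective (by simpa using h)⟩
    · rintro ⟨a, b, h⟩
      exact ⟨e.symm a, e.symm b, by rw [← h]; simp⟩
  rw [← e.height_comap p]
  refine hS (e.symm x) (e.symm y) (e.symm s) (p.comap e) inferInstance (by simpa using hx) ?_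
    (show e (e.symm x) ∈ p by rwa [e.apply_symm_apply])
    (show e (e.symm y) ∈ p by rwa [e.apply_symm_apply]) ?_ ?_
  · intro d h1 h2
    have h1' : e d ∣ x := by simpa using map_dvd e h1
    have h2' : e d ∣ y := by simpa using map_dvd e h2
    simpa using (hxy h1' h2')
  · rwa [key]
  · intro q hq
    have := hps (e q) hq
    rw [← key] at this
    simpa using this

lemma Unm.of_field (k : Type*) [Field k] : Unm k := by
  intro x y s p hp _ _ _ _ _ _
  have : p = ⊥ := (Ideal.eq_bot_or_top p).resolve_right hp.ne_top
  subst this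
  simp

open Polynomial Ideal IsLocalization in
lemma height_le_of_isMaximal {S : Type*} [CommRing S] [IsNoetherianRing S] (p : Ideal S)
    [p.IsMaximal] (P : Ideal S[X]) [P.IsPrime] [P.LiesOver p] : P.height ≤ p.height + 1 := by
  let _ : Field (S ⧸ p) := Quotient.field p
  refine (height_le_height_add_of_liesOver p P).trans ?_
  gcongr
  let e : (S[X] ⧸ (p.map (algebraMap S S[X]))) ≃+* (S ⧸ p)[X] :=
    (polynomialQuotientEquivQuotientPolynomial p).symm
  have hpr : (P.map (Ideal.Quotient.mk <| p.map (algebraMap S S[X]))).IsPrime := by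
    refine isPrime_map_quotientMk_of_isPrime ?_
    rw [LiesOver.over (P := P) (p := p)]
    exact map_comap_le
  rw [← e.height_map]
  have hne : Ideal.map e (P.map (Ideal.Quotient.mk <| p.map (algebraMap S S[X]))) ≠ ⊤ :=
    (map_isPrime_of_equiv e).ne_top
  have := Ideal.height_le_ringKrullDim_of_ne_top hne
  rw [Polynomial.ringKrullDim_of_isNoetherianRing, ringKrullDim_eq_zero_of_field] at this
  exact_mod_cast this

attribute [local instance] Polynomial.algebra Polynomial.isLocalization in
open Polynomial Ideal IsLocalization in
lemma height_comap_C {S : Type*} [CommRing S] [IsNoetherianRing S] (P : Ideal S[X])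
    [hPp : P.IsPrime] : P.height ≤ (P.comap C).height + 1 := by
  set p := P.comap (C : S →+* S[X]) with hpdef
  have : P.LiesOver p := ⟨rfl⟩
  have : p.IsPrime := comap_isPrime _ _
  let Rₚ := Localization.AtPrime p
  set p' : Ideal Rₚ := p.map (algebraMap S Rₚ) with p'_def
  have : p'.IsMaximal := by
    rw [p'_def, Localization.AtPrime.map_eq_maximalIdeal]
    exact IsLocalRing.maximalIdeal.isMaximal Rₚ
  let P' : Ideal Rₚ[X] := P.map (algebraMap S[X] Rₚ[X])
  have disj : Disjoint (p.primeCompl.map C : Set S[X]) P := by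
    refine Set.disjoint_left.mpr fun a ⟨b, hb⟩ ha ↦ hb.1 ?_
    rwa [SetLike.mem_coe, LiesOver.over (P := P) (p := p), mem_comap, algebraMap_eq, hb.2]
  have : P'.IsPrime := isPrime_of_isPrime_disjoint (p.primeCompl.map C) Rₚ[X] P hPp disj
  have : P'.LiesOver p' := liesOver_of_isPrime_of_disjoint p.primeCompl _ _ disj
  have eq1 : p.height = p'.height := by
    rw [height_map_of_disjoint p.primeCompl]
    exact Disjoint.symm <| Set.disjoint_left.mpr fun _ a b ↦ b a
  have eq2 : P.height = P'.height := by
    rw [height_map_of_disjoint (Submonoid.map C <| p.primeCompl) _ disj]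
  rw [eq1, eq2]
  exact height_le_of_isMaximal p' P'

open Polynomial in
lemma height_map_C_le {S : Type*} [CommRing S] [IsNoetherianRing S] (q : Ideal S)
    [q.IsPrime] : (q.map (C : S →+* S[X])).height ≤ q.height := by
  have hp : (q.map (C : S →+* S[X])).IsPrime := inferInstance
  have : (q.map (C : S →+* S[X])).LiesOver q := ⟨by
    ext r
    rw [Ideal.mem_comap, algebraMap_eq, Ideal.mem_map_C_iff]
    constructor
    · intro h n
      rw [coeff_C]; split_ifs
      · exact h
      · exact zero_mem _
    · intro h
      simpa using h 0⟩
  have h := Ideal.height_le_height_add_of_liesOver q (q.map (C : S →+* S[X]))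
  rw [algebraMap_eq, Ideal.map_quotient_self] at h
  have : Nontrivial (S[X] ⧸ q.map (C : S →+* S[X])) := Ideal.Quotient.nontrivial_iff.2 hp.ne_top
  simpa using h

open Polynomial in
lemma Unm.polynomial {S : Type*} [CommRing S] [IsDomain S] [UniqueFactorizationMonoid S]
    [IsNoetherianRing S] (hS : Unm S) : Unm S[X] := by
  intro x y s p hp hx hxy hxp hyp hs hps
  by_contra! hlt
  have h3 : 3 ≤ p.height := Order.add_one_le_of_lt hlt
  set q := p.comap (C : S →+* S[X]) with hq
  have hqp : q.IsPrime := Ideal.comap_isPrime _ _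
  have hq2 : 2 ≤ q.height := by
    have := h3.trans (height_comap_C p)
    rw [show (3 : ℕ∞) = 2 + 1 from rfl] at this
    exact (ENat.add_le_add_iff_right (by simp)).1 this
  have hq2' : ∀ P : Ideal S, P.IsPrime → q ≤ P → 2 ≤ P.height :=
    fun P _ hP => hq2.trans (Ideal.height_mono hP)
  have hq0 : q ≠ ⊥ := by
    intro h
    rw [h, Ideal.height_bot] at hq2
    exact absurd hq2 (by decide)
  obtain ⟨u, huq, hu⟩ := Submodule.exists_mem_ne_zero_of_ne_bot hq0
  obtain ⟨v, hvq, huv⟩ := exists_relprime q hq2' u hu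
  set K : Ideal S := Ideal.span {u, v} with hK
  have hKC : Ideal.span {C u, C v} = K.map (C : S →+* S[X]) := by
    rw [hK, Ideal.map_span, Set.image_pair]
  -- relative primality passes to polynomials
  have huv' : IsRelPrime (C u) (C v) := by
    intro d hd1 hd2
    have hdeg : d.natDegree = 0 := by
      have := natDegree_le_of_dvd hd1 (by simpa using hu)
      simpa using this
    rw [natDegree_eq_zero] at hdeg
    obtain ⟨c, rfl⟩ := hdeg
    rw [C_dvd_iff_dvd_coeff] at hd1 hd2
    exact (huv (by simpa using hd1 0) (by simpa using hd2 0)).map C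
  -- find w
  have hw : ∃ w ∈ p, ∀ P ∈ associatedPrimes S (S ⧸ K), w ∉ P.map (C : S →+* S[X]) := by
    by_contra! hcon
    have hsub : (p : Set S[X]) ⊆ ⋃ P ∈ associatedPrimes S (S ⧸ K),
        ((P.map (C : S →+* S[X]) : Ideal S[X]) : Set S[X]) := by
      intro w hw
      obtain ⟨P, hP, h⟩ := hcon w hw
      simp only [Set.mem_iUnion]
      exact ⟨P, hP, h⟩
    rw [Ideal.subset_union_prime_finite (associatedPrimes.finite _ _) 0 0
      (fun i hi _ _ => by have := (ass_data _ i hi).1; infer_instance)] at hsub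
    obtain ⟨P, hP, hle⟩ := hsub
    obtain ⟨h1, h2, s, hs, hs'⟩ := ass_data _ P hP
    have hP2 := hS u v s P h1 hu huv (h2 (Ideal.subset_span (by simp)))
      (h2 (Ideal.subset_span (by simp))) hs hs'
    have := (Ideal.height_mono hle).trans (height_map_C_le P)
    exact absurd (h3.trans (this.trans hP2)) (by decide)
  obtain ⟨w, hwp, hw⟩ := hw
  refine no_socle p hp (le_trans (by decide) h3) x y s hx hxp hxy hs hps (C u) (C v) w
    (by simpa using hu) huq hvq hwp huv' ?_
  intro r hr
  rw [hKC] at hr ⊢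
  by_contra hrK
  have hker : ∀ f : S[X], f ∈ K.map (C : S →+* S[X]) ↔ f.map (Ideal.Quotient.mk K) = 0 := by
    intro f
    rw [Ideal.mem_map_C_iff, Polynomial.ext_iff]
    simp [Ideal.Quotient.eq_zero_iff_mem]
  rw [hker] at hr hrK
  have hnz : w.map (Ideal.Quotient.mk K) ∉ nonZeroDivisors (S ⧸ K)[X] := by
    intro h
    rw [Polynomial.map_mul] at hr
    exact hrK (((mem_nonZeroDivisors_iff).1 h).1 _ hr)
  rw [Polynomial.notMem_nonZeroDivisors_iff] at hnz
  obtain ⟨c, hc0, hc⟩ := hnz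
  obtain ⟨c, rfl⟩ := Ideal.Quotient.mk_surjective c
  rw [Ne, Ideal.Quotient.eq_zero_iff_mem] at hc0
  obtain ⟨P, hP, h⟩ := ass_ann K c hc0
  refine hw P hP (Ideal.mem_map_C_iff.2 fun n => h _ ?_)
  have := congrArg (fun f => coeff f n) hc
  simp only [coeff_smul, coeff_map, coeff_zero, smul_eq_mul, ← map_mul] at this
  rw [mul_comm]
  exact Ideal.Quotient.eq_zero_iff_mem.1 this

lemma unm_mv (k : Type*) [Field k] (n : ℕ) : Unm (MvPolynomial (Fin n) k) := by
  induction n with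
  | zero => exact (Unm.of_field k).of_equiv (MvPolynomial.isEmptyRingEquiv k (Fin 0)).symm
  | succ n ih => exact ih.polynomial.of_equiv (MvPolynomial.finSuccEquiv k n).symm.toRingEquiv

lemma exists_left {R : Type*} [CommRing R] {a b : ℕ} (A : Matrix (Fin b) (Fin a) R) (f : R)
    (hf : f ∈ Ideal.span
      {m | ∃ g : Fin a → Fin b, Function.Injective g ∧ m = (A.submatrix g id).det}) :
    ∃ B : Matrix (Fin a) (Fin b) R, B * A = f • (1 : Matrix (Fin a) (Fin a) R) := by
  induction hf using Submodule.span_induction with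
  | mem m hm =>
    obtain ⟨g, -, rfl⟩ := hm
    refine ⟨(A.submatrix g id).adjugate * (1 : Matrix (Fin b) (Fin b) R).submatrix g id, ?_⟩
    have : (1 : Matrix (Fin b) (Fin b) R).submatrix g id * A = A.submatrix g id := by
      ext i j
      simp [Matrix.mul_apply, Matrix.one_apply]
    rw [Matrix.mul_assoc, this, Matrix.adjugate_mul]
  | zero => exact ⟨0, by simp⟩
  | add x y _ _ hx hy =>
    obtain ⟨B, hB⟩ := hx
    obtain ⟨D, hD⟩ := hy
    exact ⟨B + D, by rw [Matrix.add_mul, hB, hD, add_smul]⟩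
  | smul c x _ hx =>
    obtain ⟨B, hB⟩ := hx
    exact ⟨c • B, by rw [Matrix.smul_mul, hB, smul_smul, smul_eq_mul]⟩

/-- If `x, y, z` behave as a regular sequence and each scales to a left inverse of `A`, then the
cokernel of `A` is reflexive. -/
lemma reflexive_of_regular {R : Type*} [CommRing R] [IsDomain R] {a b : ℕ}
    (A : Matrix (Fin b) (Fin a) R) (x y z : R) (hx0 : x ≠ 0)
    (hx : ∃ B : Matrix (Fin a) (Fin b) R, B * A = x • (1 : Matrix (Fin a) (Fin a) R))
    (hy : ∃ B : Matrix (Fin a) (Fin b) R, B * A = y • (1 : Matrix (Fin a) (Fin a) R))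
    (hz : ∃ B : Matrix (Fin a) (Fin b) R, B * A = z • (1 : Matrix (Fin a) (Fin a) R))
    (hxy : ∀ r, x ∣ y * r → x ∣ r)
    (hxyz : ∀ r, z * r ∈ Ideal.span {x, y} → r ∈ Ideal.span {x, y}) :
    Module.IsReflexive R ((Fin b → R) ⧸ LinearMap.range A.mulVecLin) := by
  set N := LinearMap.range A.mulVecLin with hN
  have app : ∀ (B : Matrix (Fin a) (Fin b) R) (f : R),
      B * A = f • (1 : Matrix (Fin a) (Fin a) R) → ∀ w, B.mulVec (A.mulVec w) = f • w := by
    intro B f h w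
    rw [Matrix.mulVec_mulVec, h, Matrix.smul_mulVec, Matrix.one_mulVec]
  -- `x` is regular on the cokernel
  have reg1 : ∀ v : Fin b → R, x • v ∈ N → v ∈ N := by
    rintro v ⟨w, hw⟩
    obtain ⟨B, hB⟩ := hy
    have h1 := app B y hB w
    rw [Matrix.mulVecLin_apply] at hw
    rw [hw, Matrix.mulVec_smul] at h1
    have h2 : ∀ i, x ∣ w i := fun i => hxy _ ⟨B.mulVec v i, by
      have := congrFun h1 i
      simpa using this.symm⟩
    choose w' hw' using h2
    refine ⟨w', ?_⟩
    have hwx : w = x • w' := by ext i; simp [hw' i]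
    rw [hwx, Matrix.mulVec_smul] at hw
    exact smul_right_injective _ hx0 hw
  -- `y` is regular on the cokernel modulo `x`
  have reg2 : ∀ u v : Fin b → R, y • v - x • u ∈ N → ∃ v' : Fin b → R, v - x • v' ∈ N := by
    rintro u v ⟨w, hw⟩
    obtain ⟨B, hB⟩ := hz
    have h1 := app B z hB w
    rw [Matrix.mulVecLin_apply] at hw
    rw [hw, Matrix.mulVec_sub, Matrix.mulVec_smul, Matrix.mulVec_smul] at h1
    have h2 : ∀ i, w i ∈ Ideal.span {x, y} := fun i => hxyz _ (by
      have := congrFun h1 i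
      rw [Ideal.mem_span_pair]
      exact ⟨-(B.mulVec u i), B.mulVec v i, by
        simp only [Pi.sub_apply, Pi.smul_apply, smul_eq_mul] at this
        linear_combination this⟩)
    simp only [Ideal.mem_span_pair] at h2
    choose w1 w2 hw12 using h2
    have hwe : w = x • w1 + y • w2 := by
      ext i
      simp [← hw12 i, mul_comm]
    rw [hwe, Matrix.mulVec_add, Matrix.mulVec_smul, Matrix.mulVec_smul] at hw
    have h3 : ∀ i, x ∣ (v - A.mulVec w2) i := fun i => hxy _ ⟨(A.mulVec w1 + u) i, by
      have := congrFun hw i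
      simp only [Pi.sub_apply, Pi.add_apply, Pi.smul_apply, smul_eq_mul] at this ⊢
      linear_combination -this⟩
    choose v' hv' using h3
    refine ⟨v', w2, ?_⟩
    ext i
    have := hv' i
    simp only [Pi.sub_apply, Pi.smul_apply, smul_eq_mul, Matrix.mulVecLin_apply] at this ⊢
    linear_combination -this
  -- multiplication by `f` factors through a free module
  have fac : ∀ f : R, (∃ B : Matrix (Fin a) (Fin b) R,
      B * A = f • (1 : Matrix (Fin a) (Fin a) R)) →
      ∃ P : ((Fin b → R) ⧸ N) →ₗ[R] (Fin b → R), ∀ m, N.mkQ (P m) = f • m := by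
    rintro f ⟨B, hB⟩
    refine ⟨N.liftQ (f • LinearMap.id - A.mulVecLin ∘ₗ B.mulVecLin) ?_, ?_⟩
    · rintro _ ⟨w, rfl⟩
      simp [← Matrix.mulVec_mulVec, app B f hB w, Matrix.mulVec_smul]
    · intro m
      obtain ⟨v, rfl⟩ := N.mkQ_surjective m
      rw [N.mkQ_apply v, Submodule.liftQ_apply, ← N.mkQ_apply v, ← map_smul,
        ← sub_eq_zero, ← map_sub, ← LinearMap.mem_ker, Submodule.ker_mkQ]
      refine ⟨-(B.mulVec v), ?_⟩
      simp [Matrix.mulVec_neg]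
  -- the double dual modulo the cokernel is killed by such `f`
  have sur : ∀ f : R, (∃ B : Matrix (Fin a) (Fin b) R,
      B * A = f • (1 : Matrix (Fin a) (Fin a) R)) →
      ∀ φ : Module.Dual R (Module.Dual R ((Fin b → R) ⧸ N)),
      ∃ v : Fin b → R, Module.Dual.eval R _ (N.mkQ v) = f • φ := by
    intro f hf φ
    obtain ⟨P, hP⟩ := fac f hf
    refine ⟨fun i => φ (LinearMap.proj i ∘ₗ P), ?_⟩
    ext ψ
    have h1 : f • ψ = ∑ i, ψ (N.mkQ (Pi.single i 1)) •
        ((LinearMap.proj i : (Fin b → R) →ₗ[R] R) ∘ₗ P) := by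
      refine LinearMap.ext fun m => ?_
      have h2 : (f • ψ) m = ψ (N.mkQ (P m)) := by rw [hP]; simp
      rw [h2]
      conv_lhs => rw [pi_eq_sum_univ' (P m)]
      simp only [map_sum, map_smul, LinearMap.sum_apply, LinearMap.smul_apply, smul_eq_mul,
        LinearMap.comp_apply, LinearMap.proj_apply]
      refine Finset.sum_congr rfl fun i _ => ?_
      rw [mul_comm]
    have h3 : (f • φ) ψ = φ (f • ψ) := by simp
    rw [h3, h1, Module.Dual.eval_apply]
    conv_lhs => rw [pi_eq_sum_univ' (fun i => φ (LinearMap.proj i ∘ₗ P))]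
    simp only [map_sum, map_smul, smul_eq_mul]
    refine Finset.sum_congr rfl fun i _ => ?_
    rw [mul_comm]
  have inj : Function.Injective (Module.Dual.eval R ((Fin b → R) ⧸ N)) := by
    rw [injective_iff_map_eq_zero]
    intro m hm
    obtain ⟨P, hP⟩ := fac x hx
    have h0 : P m = 0 := by
      ext i
      have := LinearMap.congr_fun hm ((LinearMap.proj i : (Fin b → R) →ₗ[R] R) ∘ₗ P)
      simpa using this
    have h1 := hP m
    rw [h0, map_zero] at h1
    obtain ⟨v, rfl⟩ := N.mkQ_surjective m
    rw [← map_smul] at h1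
    have h2 : x • v ∈ N := by
      rw [← N.ker_mkQ, LinearMap.mem_ker]; exact h1.symm
    rw [← LinearMap.mem_ker, N.ker_mkQ]
    exact reg1 v h2
  refine ⟨inj, fun φ => ?_⟩
  obtain ⟨v, hv⟩ := sur x hx φ
  obtain ⟨u, hu⟩ := sur y hy φ
  have h1 : N.mkQ (y • v - x • u) = 0 := by
    apply inj
    rw [map_sub, map_smul, map_smul, map_sub, map_smul, map_smul, hv, hu, smul_comm, sub_self,
      map_zero]
  rw [← LinearMap.mem_ker, N.ker_mkQ] at h1
  obtain ⟨v', hv'⟩ := reg2 u v h1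
  rw [← N.ker_mkQ, LinearMap.mem_ker, map_sub, sub_eq_zero, map_smul] at hv'
  refine ⟨N.mkQ v', ?_⟩
  rw [hv', map_smul] at hv
  ext ψ
  have := LinearMap.congr_fun hv ψ
  simp only [LinearMap.smul_apply, smul_eq_mul] at this
  exact mul_left_cancel₀ hx0 this

end Refl

open MvPolynomial

/-- Theorem: if `α : R^a → R^b` (`a < b`) is injective and the ideal of `a × a` minors of
its matrix has height at least `3`, then `coker α` is a reflexive module. -/
theorem stmt_4 {k : Type*} [Field k] (n : ℕ) (hn : 1 ≤ n)
    (a b : ℕ) (hab : a < b)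
    (A : Matrix (Fin b) (Fin a) (MvPolynomial (Fin (n + 1)) k))
    (hinj : Function.Injective A.mulVecLin)
    (hheight : 3 ≤ idealHeight (Ideal.span
      {m | ∃ g : Fin a → Fin b, Function.Injective g ∧ m = (A.submatrix g id).det})) :
    Module.IsReflexive (MvPolynomial (Fin (n + 1)) k)
      ((Fin b → MvPolynomial (Fin (n + 1)) k) ⧸ LinearMap.range A.mulVecLin) := by
  have hL := Refl.exists_left A
  set I := Ideal.span
      {m | ∃ g : Fin a → Fin b, Function.Injective g ∧ m = (A.submatrix g id).det} with hI
  have h3 : ∀ P : Ideal (MvPolynomial (Fin (n + 1)) k), P.IsPrime → I ≤ P → 3 ≤ P.height := by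
    intro P hP hle
    have h1 : idealHeight I ≤ Order.height (⟨P, hP⟩ : PrimeSpectrum _) :=
      iInf₂_le (⟨P, hP⟩ : PrimeSpectrum (MvPolynomial (Fin (n + 1)) k)) hle
    have h2 : P.height = Order.height (⟨P, hP⟩ : PrimeSpectrum _) :=
      PrimeSpectrum.height_eq_orderHeight (⟨P, hP⟩ : PrimeSpectrum _)
    rw [h2]
    exact hheight.trans h1
  have h0 : I ≠ ⊥ := by
    intro h
    have := h3 ⊥ Ideal.isPrime_bot h.le
    rw [Ideal.height_bot] at this
    exact absurd this (by decide)
  obtain ⟨x, hxI, hx⟩ := Submodule.exists_mem_ne_zero_of_ne_bot h0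
  obtain ⟨y, hyI, hxy⟩ := Refl.exists_relprime I
    (fun P hP h => le_trans (by decide) (h3 P hP h)) x hx
  obtain ⟨z, hzI, hz⟩ := (Refl.unm_mv k (n + 1)).exists_regular I h3 x y hx hxy
  exact Refl.reflexive_of_regular A x y z hx (hL x hxI) (hL y hyI) (hL z hzI)
    (fun r h => hxy.dvd_of_dvd_mul_left h) hz
end

section
/- Let k be a field of characteristic 0, R = k[x_0,…,x_4], f = x_2² − 2x_1x_3 + 2x_0x_4 and g = 2x_2³ − 6x_1x_2x_3 + 9x_0x_3² + 6x_1²x_4 − 12x_0x_2x_4, and set σ' = (f, x_0·f + g). Then the R-module T_{σ'} = {v ∈ R^5 : ∑_{j=0}^4 v_j · ∂f/∂x_j = 0 and ∑_{j=0}^4 v_j · ∂(x_0 f + g)/∂x_j = 0} is NOT a free R-module. -/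
open MvPolynomial

namespace Stmt14

/-- Half of the gradient of `f`. -/
noncomputable def a (k : Type*) [Field k] : Fin 5 → MvPolynomial (Fin 5) k :=
  ![X 4, - X 3, X 2, - X 1, X 0]

/-- `f • e₀ + ∇ g`. -/
noncomputable def h (k : Type*) [Field k] : Fin 5 → MvPolynomial (Fin 5) k :=
  ![X 2 ^ 2 - 2 * X 1 * X 3 + 2 * X 0 * X 4 + 9 * X 3 ^ 2 - 12 * X 2 * X 4,
    -6 * X 2 * X 3 + 12 * X 1 * X 4,
    6 * X 2 ^ 2 - 6 * X 1 * X 3 - 12 * X 0 * X 4,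
    -6 * X 1 * X 2 + 18 * X 0 * X 3,
    6 * X 1 ^ 2 - 12 * X 0 * X 2]

/-- The two by two minors. -/
noncomputable def M (k : Type*) [Field k] (i j : Fin 5) : MvPolynomial (Fin 5) k :=
  a k i * h k j - a k j * h k i

/-- Membership in the syzygy module. -/
def Mem {k : Type*} [Field k] (v : Fin 5 → MvPolynomial (Fin 5) k) : Prop :=
  ∑ j, a k j * v j = 0 ∧ ∑ j, h k j * v j = 0

/-- Koszul type syzygies. -/
noncomputable def w (k : Type*) [Field k] (p q l : Fin 5) : Fin 5 → MvPolynomial (Fin 5) k :=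
  Pi.single l (M k p q) - Pi.single p (M k l q) + Pi.single q (M k l p)

variable {k : Type*} [Field k]

lemma w_mem (p q l : Fin 5) : Mem (w k p q l) := by
  constructor <;>
  · simp only [w, Pi.add_apply, Pi.sub_apply, mul_add, mul_sub, Finset.sum_add_distrib,
      Finset.sum_sub_distrib, Pi.single_apply, mul_ite, mul_zero, Finset.sum_ite_eq',
      Finset.mem_univ, if_true, M]
    ring

lemma mem_rel {v : Fin 5 → MvPolynomial (Fin 5) k} (hv : Mem v) (q : Fin 5) :
    ∑ j, M k j q * v j = 0 := by
  obtain ⟨h1, h2⟩ := hv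
  have : ∑ j, M k j q * v j = h k q * ∑ j, a k j * v j - a k q * ∑ j, h k j * v j := by
    simp only [Finset.mul_sum, ← Finset.sum_sub_distrib, M]
    exact Finset.sum_congr rfl fun j _ => by ring
  rw [this, h1, h2]; ring

/-- substitution `(s, t, 0, 0, s)` -/
noncomputable def psi (k : Type*) [Field k] :
    MvPolynomial (Fin 5) k →ₐ[k] MvPolynomial (Fin 2) k :=
  aeval ![X 0, X 1, 0, 0, X 0]

/-- substitution `(0, t, s, 0, 0)` -/
noncomputable def theta (k : Type*) [Field k] :
    MvPolynomial (Fin 5) k →ₐ[k] MvPolynomial (Fin 2) k :=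
  aeval ![0, X 1, X 0, 0, 0]

/-- substitution `s = 0` -/
noncomputable def eps (k : Type*) [Field k] :
    MvPolynomial (Fin 2) k →ₐ[k] Polynomial k :=
  aeval ![0, Polynomial.X]

/-- substitution `(0, 0, 0, t, 0)` -/
noncomputable def chi (k : Type*) [Field k] :
    MvPolynomial (Fin 5) k →ₐ[k] Polynomial k :=
  aeval ![0, 0, 0, Polynomial.X, 0]

lemma psi_X (j : Fin 5) :
    psi k (X j) = (![X 0, X 1, 0, 0, X 0] : Fin 5 → MvPolynomial (Fin 2) k) j :=
  aeval_X _ _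

lemma theta_X (j : Fin 5) :
    theta k (X j) = (![0, X 1, X 0, 0, 0] : Fin 5 → MvPolynomial (Fin 2) k) j :=
  aeval_X _ _

lemma chi_X (j : Fin 5) :
    chi k (X j) = (![0, 0, 0, Polynomial.X, 0] : Fin 5 → Polynomial k) j :=
  aeval_X _ _

lemma eps_comp : (eps k).comp (psi k) = (eps k).comp (theta k) := by
  ext i
  fin_cases i <;> simp [eps, psi, theta]

lemma eps_eq (p : MvPolynomial (Fin 5) k) : eps k (psi k p) = eps k (theta k p) :=
  DFunLike.congr_fun eps_comp p

lemma psi_M34 : psi k (M k 3 4) = -6 * X 1 ^ 3 := by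
  simp [map_ofNat (psi k) 6, map_ofNat (psi k) 12, psi_X, M, a, h]; ring

lemma psi_M24 : psi k (M k 2 4) = 12 * X 0 ^ 3 := by
  simp [map_ofNat (psi k) 6, map_ofNat (psi k) 12, psi_X, M, a, h]; ring

lemma const_eq : (Polynomial.aeval (0:k)).comp (chi k)
    = (Polynomial.aeval (0:k)).comp ((eps k).comp (psi k)) := by
  ext i
  fin_cases i <;> simp [eps, psi, chi]

lemma prX (i : Fin 2) : Prime (X i : MvPolynomial (Fin 2) k) := X_prime

lemma not_dvd_aux {i j : Fin 2} (hij : i ≠ j) (n : ℕ) :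
    ¬ (X i : MvPolynomial (Fin 2) k) ∣ X j ^ n := by
  intro hd
  have h1 := (prX (k := k) i).dvd_of_dvd_pow hd
  rw [X_dvd_X] at h1
  simp_all

lemma order {v : Fin 5 → MvPolynomial (Fin 5) k} (hv : Mem v) :
    Polynomial.X ^ 2 ∣ eps k (psi k (v 0)) ∧ Polynomial.X ∣ eps k (psi k (v 1)) ∧
    Polynomial.X ∣ eps k (psi k (v 2)) := by
  obtain ⟨h1, h2⟩ := hv
  have e1 := congrArg (theta k) h1
  have e2 := congrArg (theta k) h2
  have e3 := congrArg (chi k) h1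
  simp [Fin.sum_univ_five, a, h, theta_X, chi_X, map_ofNat (theta k) 6] at e1 e2 e3
  refine ⟨?_, ?_, ?_⟩
  · have hd : (X 1 : MvPolynomial (Fin 2) k) ^ 2 ∣ X 0 ^ 2 * theta k (v 0) :=
      ⟨- 6 * theta k (v 4), by linear_combination e2 - 6 * X 0 * e1⟩
    have := (prX (k := k) (1 : Fin 2)).pow_dvd_of_dvd_mul_left 2
      (not_dvd_aux (by decide) 2) hd
    have := map_dvd (eps k) this
    rw [eps_eq]
    simpa [eps] using this
  · rw [Polynomial.X_dvd_iff, Polynomial.coeff_zero_eq_aeval_zero]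
    have := DFunLike.congr_fun (const_eq (k := k)) (v 1)
    simp only [AlgHom.comp_apply] at this
    rw [← this, e3, map_zero]
  · have hd : (X 1 : MvPolynomial (Fin 2) k) ^ 1 ∣ X 0 ^ 1 * theta k (v 2) :=
      ⟨theta k (v 3), by linear_combination e1⟩
    have := (prX (k := k) (1 : Fin 2)).pow_dvd_of_dvd_mul_left 1
      (not_dvd_aux (by decide) 1) hd
    have := map_dvd (eps k) this
    rw [eps_eq]
    simpa [eps] using this

/-- matrix of selected coordinates -/
def P (b : Fin 3 → Fin 5 → MvPolynomial (Fin 5) k) (r : Fin 3 → Fin 5) :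
    Matrix (Fin 3) (Fin 3) (MvPolynomial (Fin 5) k) := Matrix.of fun i j => b i (r j)

lemma det_dvd (b : Fin 3 → Fin 5 → MvPolynomial (Fin 5) k)
    (hspan : ∀ v, Mem v → ∃ c : Fin 3 → MvPolynomial (Fin 5) k, v = ∑ i, c i • b i)
    (p q : Fin 5) (r : Fin 3 → Fin 5) (hr : Function.Injective r)
    (hp : ∀ i, r i ≠ p) (hq : ∀ i, r i ≠ q) : (P b r).det ∣ M k p q ^ 3 := by
  choose c hc using fun l : Fin 3 => hspan (w k p q (r l)) (w_mem _ _ _)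
  have : Matrix.of c * P b r = M k p q • (1 : Matrix (Fin 3) (Fin 3) _) := by
    ext1 l j
    have := congrFun (hc l) (r j)
    simp only [Matrix.mul_apply, Matrix.of_apply, P]
    simp only [Finset.sum_apply, Pi.smul_apply, smul_eq_mul] at this
    rw [← this]
    simp [w, Pi.single_apply, hp, hq, Matrix.one_apply, hr.eq_iff, eq_comm]
  have := congrArg Matrix.det this
  rw [Matrix.det_mul, Matrix.det_smul, Matrix.det_one] at this
  exact ⟨(Matrix.of c).det, by simpa [mul_comm] using this.symm⟩

lemma main_aux [CharZero k] (b : Fin 3 → Fin 5 → MvPolynomial (Fin 5) k)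
    (hb : ∀ i, Mem (b i))
    (hspan : ∀ v, Mem v → ∃ c : Fin 3 → MvPolynomial (Fin 5) k, v = ∑ i, c i • b i) :
    False := by
  have d34 := det_dvd b hspan 3 4 ![0, 1, 2] (by decide) (by decide) (by decide)
  have d24 := det_dvd b hspan 2 4 ![0, 1, 3] (by decide) (by decide) (by decide)
  have prop : M k 3 4 * (P b ![0, 1, 3]).det = - M k 2 4 * (P b ![0, 1, 2]).det := by
    have r := fun i => mem_rel (hb i) 4
    have m44 : M k 4 4 = 0 := by simp [M]
    simp only [Fin.sum_univ_five, m44] at r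
    simp only [Matrix.det_fin_three, P, Matrix.of_apply, Matrix.cons_val]
    linear_combination (b 1 0 * b 2 1 - b 1 1 * b 2 0) * r 0
      - (b 0 0 * b 2 1 - b 0 1 * b 2 0) * r 1 + (b 0 0 * b 1 1 - b 0 1 * b 1 0) * r 2
  have ord : (Polynomial.X : Polynomial k) ^ 4 ∣ eps k (psi k (P b ![0, 1, 2]).det) := by
    choose u0 u1 u2 using fun i => order (hb i)
    choose u0 h0 using u0
    choose u1 h1 using u1
    choose u2 h2 using u2
    simp only [Matrix.det_fin_three, P, Matrix.of_apply, Matrix.cons_val, map_add, map_sub,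
      map_mul, h0, h1, h2]
    exact ⟨u0 0 * u1 1 * u2 2 - u0 0 * u2 1 * u1 2 - u1 0 * u0 1 * u2 2 + u1 0 * u2 1 * u0 2
      + u2 0 * u0 1 * u1 2 - u2 0 * u1 1 * u0 2, by ring⟩
  have d34 := map_dvd (psi k) d34
  have d24 := map_dvd (psi k) d24
  have prop := congrArg (psi k) prop
  simp only [map_mul, map_neg, map_pow, psi_M34, psi_M24] at d34 d24 prop
  set A := psi k (P b ![0, 1, 2]).det
  set D := psi k (P b ![0, 1, 3]).det
  have c6 : IsUnit (-6 : MvPolynomial (Fin 2) k) := by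
    have := (IsUnit.mk0 (6 : k) (by norm_num)).map (C : k →+* MvPolynomial (Fin 2) k)
    rw [map_ofNat C 6] at this
    exact this.neg
  have c12 : IsUnit (12 : MvPolynomial (Fin 2) k) := by
    have := (IsUnit.mk0 (12 : k) (by norm_num)).map (C : k →+* MvPolynomial (Fin 2) k)
    rw [map_ofNat C 12] at this
    exact this
  have hA : (X 1 : MvPolynomial (Fin 2) k) ^ 3 ∣ A := by
    have hd : (X 1 : MvPolynomial (Fin 2) k) ^ 3 ∣ X 0 ^ 3 * A := by
      rw [← c12.dvd_mul_left]
      exact ⟨6 * D, by linear_combination prop⟩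
    exact (prX (k := k) (1 : Fin 2)).pow_dvd_of_dvd_mul_left 3
      (not_dvd_aux (by decide) 3) hd
  obtain ⟨A', hA'⟩ := hA
  have hD : (-6) * D = -12 * X 0 ^ 3 * A' := by
    have : (X 1 : MvPolynomial (Fin 2) k) ^ 3 ≠ 0 := pow_ne_zero _ (X_ne_zero _)
    apply mul_left_cancel₀ this
    rw [hA'] at prop
    linear_combination prop
  have q1 : A' ∣ (X 1 : MvPolynomial (Fin 2) k) ^ 9 := by
    have : A' ∣ ((-6) * X 1 ^ 3) ^ 3 := (Dvd.intro_left _ hA'.symm).trans d34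
    rw [mul_pow, (c6.pow 3).dvd_mul_left, ← pow_mul] at this
    exact this
  have q2 : A' ∣ (X 0 : MvPolynomial (Fin 2) k) ^ 9 := by
    have : A' ∣ (-6) * D := Dvd.intro_left _ hD.symm
    rw [c6.dvd_mul_left] at this
    have := this.trans d24
    rw [mul_pow, (c12.pow 3).dvd_mul_left, ← pow_mul] at this
    exact this
  have hu : IsUnit A' := by
    obtain ⟨i, -, hi⟩ := (dvd_prime_pow (prX (k := k) (1 : Fin 2)) 9).1 q1
    rcases Nat.eq_zero_or_pos i with rfl | hpos
    · rw [pow_zero] at hi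
      exact hi.isUnit_iff.2 isUnit_one
    · exfalso
      have : (X 1 : MvPolynomial (Fin 2) k) ∣ A' := (dvd_pow_self _ hpos.ne').trans hi.symm.dvd
      exact not_dvd_aux (by decide) 9 (this.trans q2)
  have hu' := hu.map (eps k)
  have : eps k A = Polynomial.X ^ 3 * eps k A' := by
    rw [hA']; simp [eps]
  rw [this, hu'.dvd_mul_right, pow_dvd_pow_iff Polynomial.X_ne_zero Polynomial.not_isUnit_X] at ord
  omega

lemma M34_ne [CharZero k] : M k 3 4 ≠ 0 := by
  intro h0
  have := psi_M34 (k := k)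
  rw [h0, map_zero] at this
  have h6 : (-6 : MvPolynomial (Fin 2) k) ≠ 0 := by norm_num
  exact mul_ne_zero h6 (pow_ne_zero 3 (X_ne_zero _)) this.symm

lemma not_free [CharZero k]
    (T : Submodule (MvPolynomial (Fin 5) k) (Fin 5 → MvPolynomial (Fin 5) k))
    (hT : ∀ v, v ∈ T ↔ Mem v) : ¬ Module.Free (MvPolynomial (Fin 5) k) T := by
  intro hfree
  let r : Fin 3 → Fin 5 := ![0, 1, 2]
  let pr : T →ₗ[MvPolynomial (Fin 5) k] (Fin 3 → MvPolynomial (Fin 5) k) :=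
    (LinearMap.funLeft _ _ r).comp T.subtype
  have hpr : Function.Injective pr := by
    rw [← LinearMap.ker_eq_bot, LinearMap.ker_eq_bot']
    rintro ⟨v, hv⟩ h0
    have z0 : v 0 = 0 := congrFun h0 0
    have z1 : v 1 = 0 := congrFun h0 1
    have z2 : v 2 = 0 := congrFun h0 2
    have r4 := mem_rel ((hT v).1 hv) 4
    have r3 := mem_rel ((hT v).1 hv) 3
    have m44 : M k 4 4 = 0 := by simp [M]
    have m33 : M k 3 3 = 0 := by simp [M]
    have m43 : M k 4 3 = - M k 3 4 := by simp [M]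
    simp [Fin.sum_univ_five, z0, z1, z2, m44, m33, m43, M34_ne] at r3 r4
    ext1
    funext j
    fin_cases j <;> simp [z0, z1, z2, r3, r4]
  let ww : (Fin 3 → MvPolynomial (Fin 5) k) →ₗ[MvPolynomial (Fin 5) k] T :=
    Fintype.linearCombination _ (fun l => (⟨w k 3 4 (r l), (hT _).2 (w_mem _ _ _)⟩ : T))
  have hww : Function.Injective ww := by
    rw [← LinearMap.ker_eq_bot, LinearMap.ker_eq_bot']
    intro c hc
    have hc' := congrArg Subtype.val hc
    have e := fun j => congrFun hc' (r j)
    funext j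
    have := e j
    fin_cases j <;>
      simpa [ww, Fintype.linearCombination_apply, Fin.sum_univ_three, w, r, M34_ne] using this
  have l1 := LinearMap.finrank_le_finrank_of_injective hpr
  have l2 := LinearMap.finrank_le_finrank_of_injective hww
  rw [Module.finrank_fin_fun] at l1 l2
  let B := Module.finBasisOfFinrankEq (MvPolynomial (Fin 5) k) T (le_antisymm l1 l2)
  refine main_aux (fun i => (B i : Fin 5 → MvPolynomial (Fin 5) k))
    (fun i => (hT _).1 (B i).2) ?_
  intro v hv
  refine ⟨fun i => B.repr ⟨v, (hT v).2 hv⟩ i, ?_⟩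
  have := congrArg T.subtype (B.sum_repr ⟨v, (hT v).2 hv⟩)
  rw [map_sum] at this
  exact this.symm

end Stmt14

/-- Theorem: for `f = x₂² − 2x₁x₃ + 2x₀x₄`,
`g = 2x₂³ − 6x₁x₂x₃ + 9x₀x₃² + 6x₁²x₄ − 12x₀x₂x₄` and the sequence
`σ' = (f, x₀·f + g)`, the Jacobian syzygy module `T_{σ'}` is NOT free. -/
theorem stmt_14 {k : Type*} [Field k] [CharZero k]
    (f g : MvPolynomial (Fin 5) k)
    (hfdef : f = X 2 ^ 2 - 2 * X 1 * X 3 + 2 * X 0 * X 4)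
    (hgdef : g = 2 * X 2 ^ 3 - 6 * X 1 * X 2 * X 3 + 9 * X 0 * X 3 ^ 2
      + 6 * X 1 ^ 2 * X 4 - 12 * X 0 * X 2 * X 4) :
    ¬ Module.Free (MvPolynomial (Fin 5) k)
        (LinearMap.ker ((Matrix.of fun (i : Fin 2) (j : Fin 5) =>
          pderiv j (if i = 0 then f else X 0 * f + g)).mulVecLin)) := by
  apply Stmt14.not_free
  have pd : ∀ (j : Fin 5) (n : ℕ) [n.AtLeastTwo],
      pderiv j (OfNat.ofNat n : MvPolynomial (Fin 5) k) = 0 := by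
    intro j n _
    exact (pderiv j).map_natCast n
  have hf : ∀ j, pderiv j f = 2 * Stmt14.a k j := by
    intro j
    subst hfdef
    fin_cases j <;> simp [pderiv_X, Stmt14.a, pd] <;> ring
  have hg : ∀ j, pderiv j (X 0 * f + g) = 2 * X 0 * Stmt14.a k j + Stmt14.h k j := by
    intro j
    rw [map_add, Derivation.leibniz, hf]
    subst hfdef hgdef
    fin_cases j <;> simp [pderiv_X, Stmt14.a, Stmt14.h, pd] <;> ring
  intro v
  rw [LinearMap.mem_ker, Matrix.mulVecLin_apply, _root_.funext_iff, Fin.forall_fin_two]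
  simp only [Matrix.mulVec, dotProduct, Matrix.of_apply, if_true, one_ne_zero, if_false, hf, hg,
    Pi.zero_apply, add_mul, Finset.sum_add_distrib, mul_assoc, ← Finset.mul_sum]
  unfold Stmt14.Mem
  constructor
  · rintro ⟨h1, h2⟩
    have h1 : ∑ j, Stmt14.a k j * v j = 0 := by simpa using h1
    exact ⟨h1, by simpa [h1] using h2⟩
  · rintro ⟨h1, h2⟩
    simp [h1, h2]
end
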